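/- Let m ≥ 1 be an integer, q = 2^m, and let D be the q²×q² matrix over 𝔽_q with rows and columns indexed by 𝔽_q × 𝔽_q and entries D((x₁,x₂),(y₁,y₂)) = (x₁²y₁ + x₁y₁² + x₂ + y₂)^{q−1}. Then rank(D) ≤ ((1+√2)/2)·(2+√2)^m, where the inequality is between real numbers. -/

import Mathlib

/-- The pairs `(∑ εᵢ 2^i, ∑ δᵢ 2^i)` over `i < m` with
`(εᵢ, δᵢ) ∈ {(0, 0), (1, 0), (2, 0), (0, 1)}`. -/
def monomialExponents : ℕ → Finset (ℕ × ℕ)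
  | 0 => {(0, 0)}
  | m + 1 =>
    (monomialExponents m ∪ (monomialExponents m).image fun r => (r.1 + 1, r.2)).image
        (fun r => (2 * r.1, 2 * r.2)) ∪
      (monomialExponents m).image (fun r => (2 * r.1 + 1, 2 * r.2)) ∪
      (monomialExponents m).image (fun r => (2 * r.1, 2 * r.2 + 1))

/-- The exponent pairs together with their translates by `(1, 0)`. -/
def shiftedExponents (m : ℕ) : Finset (ℕ × ℕ) :=
  monomialExponents m ∪ (monomialExponents m).image fun r => (r.1 + 1, r.2)

theorem card_monomialExponents_succ_le (m : ℕ) :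
    (monomialExponents (m + 1)).card ≤
      2 * (monomialExponents m).card + (shiftedExponents m).card := by
  rw [monomialExponents, ← shiftedExponents]
  grw [Finset.card_union_le, Finset.card_union_le, Finset.card_image_le, Finset.card_image_le,
    Finset.card_image_le]
  omega

theorem card_shiftedExponents_succ_le (m : ℕ) :
    (shiftedExponents (m + 1)).card ≤
      2 * (monomialExponents m).card + 2 * (shiftedExponents m).card := by
  have hsub : shiftedExponents (m + 1) ⊆
      (shiftedExponents m).image (fun r => (2 * r.1, 2 * r.2)) ∪
      (shiftedExponents m).image (fun r => (2 * r.1 + 1, 2 * r.2)) ∪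
      (monomialExponents m).image (fun r => (2 * r.1, 2 * r.2 + 1)) ∪
      (monomialExponents m).image (fun r => (2 * r.1 + 1, 2 * r.2 + 1)) := by
    intro p hp
    rw [shiftedExponents, monomialExponents, ← shiftedExponents] at hp
    have hmem : ∀ r ∈ monomialExponents m, r ∈ shiftedExponents m := fun r hr =>
      Finset.mem_union_left _ hr
    have hshift : ∀ r ∈ monomialExponents m, (r.1 + 1, r.2) ∈ shiftedExponents m := fun r hr =>
      Finset.mem_union_right _ (Finset.mem_image_of_mem _ hr)
    simp only [Finset.mem_union, Finset.mem_image] at hp ⊢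
    rcases hp with ((⟨r, hr, rfl⟩ | ⟨r, hr, rfl⟩) | ⟨r, hr, rfl⟩) |
      ⟨_, (⟨r, hr, rfl⟩ | ⟨r, hr, rfl⟩) | ⟨r, hr, rfl⟩, rfl⟩
    · exact Or.inl (Or.inl (Or.inl ⟨r, hr, rfl⟩))
    · exact Or.inl (Or.inl (Or.inr ⟨r, hmem r hr, rfl⟩))
    · exact Or.inl (Or.inr ⟨r, hr, rfl⟩)
    · exact Or.inl (Or.inl (Or.inr ⟨r, hr, rfl⟩))
    · exact Or.inl (Or.inl (Or.inl ⟨_, hshift r hr, rfl⟩))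
    · exact Or.inr ⟨r, hr, rfl⟩
  grw [hsub, Finset.card_union_le, Finset.card_union_le, Finset.card_union_le,
    Finset.card_image_le, Finset.card_image_le, Finset.card_image_le, Finset.card_image_le]
  omega

theorem card_exponents_le (m : ℕ) :
    ((monomialExponents m).card : ℝ) ≤
        (1 + √2) / 2 * (2 + √2) ^ m + (1 - √2) / 2 * (2 - √2) ^ m ∧
      ((shiftedExponents m).card : ℝ) ≤
        (2 + √2) / 2 * (2 + √2) ^ m + (2 - √2) / 2 * (2 - √2) ^ m := by
  have hsq : √2 * √2 = (2 : ℝ) := Real.mul_self_sqrt (by norm_num)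
  induction m with
  | zero =>
    have h : (shiftedExponents 0).card = 2 := by decide
    rw [h]
    constructor
    · simp only [monomialExponents, Finset.card_singleton]
      norm_num
      linarith
    · norm_num
      linarith
  | succ m ih =>
    obtain ⟨ha, hb⟩ := ih
    have h₁ : ((monomialExponents (m + 1)).card : ℝ) ≤
        2 * (monomialExponents m).card + (shiftedExponents m).card := by
      exact_mod_cast card_monomialExponents_succ_le m
    have h₂ : ((shiftedExponents (m + 1)).card : ℝ) ≤
        2 * (monomialExponents m).card + 2 * (shiftedExponents m).card := by
      exact_mod_cast card_shiftedExponents_succ_le m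
    constructor
    · refine (h₁.trans (add_le_add (mul_le_mul_of_nonneg_left ha zero_le_two) hb)).trans_eq ?_
      linear_combination (-(2 + √2) ^ m / 2 + (2 - √2) ^ m * (-1 / 2)) * hsq
    · refine (h₂.trans (add_le_add (mul_le_mul_of_nonneg_left ha zero_le_two)
        (mul_le_mul_of_nonneg_left hb zero_le_two))).trans_eq ?_
      linear_combination (-(2 + √2) ^ m / 2 + (2 - √2) ^ m * (-1 / 2)) * hsq

theorem card_monomialExponents_le (m : ℕ) :
    ((monomialExponents m).card : ℝ) ≤ (1 + √2) / 2 * (2 + √2) ^ m := by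
  have h₁ : 1 ≤ √2 := Real.one_le_sqrt.2 one_le_two
  have h₂ : √2 ≤ 2 := Real.sqrt_le_iff.2 (by norm_num)
  have h₃ : (1 - √2) / 2 * (2 - √2) ^ m ≤ 0 :=
    mul_nonpos_of_nonpos_of_nonneg (by linarith) (pow_nonneg (by linarith) m)
  linarith [(card_exponents_le m).1]

/-- The function `x ↦ x₁ ^ r₁ * x₂ ^ r₂` on pairs. -/
def monomialFun (F : Type*) [CommSemiring F] (r : ℕ × ℕ) (x : F × F) : F :=
  x.1 ^ r.1 * x.2 ^ r.2

theorem pow_mem_span_monomialFun {F : Type*} [Field F] [CharP F 2] (a b c : F) (m : ℕ) :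
    (fun x : F × F => (x.1 ^ 2 * a + x.1 * b + x.2 + c) ^ (2 ^ m - 1)) ∈
      Submodule.span F (monomialFun F '' (monomialExponents m : Set (ℕ × ℕ))) := by
  induction m with
  | zero =>
    refine Submodule.subset_span ⟨(0, 0), by simp [monomialExponents], ?_⟩
    funext x
    simp [monomialFun]
  | succ m ih =>
    set S := Submodule.span F (monomialFun F '' (monomialExponents (m + 1) : Set (ℕ × ℕ)))
    have key : ∀ f ∈ Submodule.span F (monomialFun F '' (monomialExponents m : Set (ℕ × ℕ))),
        (fun x : F × F => f x ^ 2 * (x.1 ^ 2 * a + x.1 * b + x.2 + c)) ∈ S := by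
      intro f hf
      induction hf using Submodule.span_induction with
      | mem f hf =>
        obtain ⟨r, hr, rfl⟩ := hf
        rw [Finset.mem_coe] at hr
        have mem (s) (hs : s ∈ monomialExponents (m + 1)) : monomialFun F s ∈ S :=
          Submodule.subset_span ⟨s, hs, rfl⟩
        have h₀ := mem (2 * r.1, 2 * r.2) (by
          simp only [monomialExponents, Finset.mem_union, Finset.mem_image]
          exact Or.inl (Or.inl ⟨r, Or.inl hr, rfl⟩))
        have h₁ := mem (2 * r.1 + 1, 2 * r.2) (by
          simp only [monomialExponents, Finset.mem_union, Finset.mem_image]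
          exact Or.inl (Or.inr ⟨r, hr, rfl⟩))
        have h₂ := mem (2 * (r.1 + 1), 2 * r.2) (by
          simp only [monomialExponents, Finset.mem_union, Finset.mem_image]
          exact Or.inl (Or.inl ⟨_, Or.inr ⟨r, hr, rfl⟩, rfl⟩))
        have h₃ := mem (2 * r.1, 2 * r.2 + 1) (by
          simp only [monomialExponents, Finset.mem_union, Finset.mem_image]
          exact Or.inr ⟨r, hr, rfl⟩)
        convert S.add_mem (S.add_mem (S.add_mem (S.smul_mem a h₂) (S.smul_mem b h₁)) h₃)
          (S.smul_mem c h₀) using 1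
        funext x
        simp only [monomialFun, Pi.add_apply, Pi.smul_apply, smul_eq_mul]
        ring
      | zero =>
        convert S.zero_mem using 1
        funext x
        simp
      | add f g _ _ hf hg =>
        convert S.add_mem hf hg using 1
        funext x
        simp only [Pi.add_apply, CharTwo.add_sq]
        ring
      | smul t f _ hf =>
        convert S.smul_mem (t ^ 2) hf using 1
        funext x
        simp only [Pi.smul_apply, smul_eq_mul]
        ring
    convert key _ ih using 1
    funext x
    have hpos : 1 ≤ 2 ^ m := Nat.one_le_two_pow
    rw [← pow_mul, ← pow_succ, pow_succ 2 m]
    congr 1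
    omega

/-- For `q = 2^m`, the matrix `D` over `𝔽_q` indexed by `𝔽_q × 𝔽_q` with
entries `D((x₁,x₂),(y₁,y₂)) = (x₁²y₁ + x₁y₁² + x₂ + y₂)^{q−1}` satisfies
`rank(D) ≤ ((1+√2)/2)·(2+√2)^m` as real numbers. -/
theorem stmt_2 (m : ℕ) (hm : 1 ≤ m) (F : Type) [Field F] [Fintype F] [DecidableEq F]
    (hF : Fintype.card F = 2 ^ m)
    (D : Matrix (F × F) (F × F) F)
    (hD : ∀ x y : F × F, D x y =
      (x.1 ^ 2 * y.1 + x.1 * y.1 ^ 2 + x.2 + y.2) ^ (2 ^ m - 1)) :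
    (D.rank : ℝ) ≤ (1 + Real.sqrt 2) / 2 * (2 + Real.sqrt 2) ^ m := by
  have : Fact (Nat.Prime 2) := ⟨Nat.prime_two⟩
  have : CharP F 2 := charP_of_card_eq_prime_pow hF
  classical
  have hrank : D.rank ≤ (monomialExponents m).card := by
    have hspan : Submodule.span F (Set.range D.col) ≤ Submodule.span F
        (((monomialExponents m).image (monomialFun F) : Finset (F × F → F)) :
          Set (F × F → F)) := by
      rw [Submodule.span_le, Finset.coe_image]
      rintro _ ⟨y, rfl⟩
      rw [SetLike.mem_coe]
      convert pow_mem_span_monomialFun y.1 (y.1 ^ 2) y.2 m using 1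
      funext x
      exact hD x y
    rw [Matrix.rank_eq_finrank_span_cols]
    exact (Submodule.finrank_mono hspan).trans
      ((finrank_span_finset_le_card _).trans Finset.card_image_le)
  exact le_trans (by exact_mod_cast hrank) (card_monomialExponents_le m)
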